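/- Let T be an (α,β)-RK operator on a complex Banach space X with α, β ≥ 0, and let k ∈ ℕ ∪ {0}. Then there exist a constant M > 0 and N ∈ ℕ such that for all n ≥ N: if α(k+1) < 2 then ‖T^{n+1} − T^n‖ ≤ M n^{k(β−1)+β}; if α(k+1) = 2 then ‖T^{n+1} − T^n‖ ≤ M n^{k(β−1)+β} log(n); and if α(k+1) > 2 then ‖T^{n+1} − T^n‖ ≤ M n^{(α+β−1)(k+1)−1}. -/

import Mathlib

/-- A bounded linear operator `T` on a complex Banach space is `(α,β)`-RK with constant `C` if
`C ≥ 1` and for every `λ ∈ ℂ` with `|λ| > 1` the operator `λI − T` is invertible with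
`‖(λI − T)⁻¹‖ ≤ C |λ|^(α+β−1) / (|λ−1|^α (|λ|−1)^β)`. -/
def IsRK {X : Type*} [NormedAddCommGroup X] [NormedSpace ℂ X]
    (T : X →L[ℂ] X) (α β C : ℝ) : Prop :=
  1 ≤ C ∧ ∀ lam : ℂ, 1 < ‖lam‖ →
    IsUnit (algebraMap ℂ (X →L[ℂ] X) lam - T) ∧
    ‖Ring.inverse (algebraMap ℂ (X →L[ℂ] X) lam - T)‖ ≤
      C * ‖lam‖ ^ (α + β - 1) / (‖lam - 1‖ ^ α * (‖lam‖ - 1) ^ β)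

theorem differentiableAt_inverse_one_sub_smul {A : Type*} [NormedRing A] [NormedAlgebra ℂ A]
    [CompleteSpace A] (a : A) {z : ℂ} (hz : IsUnit (1 - z • a)) :
    DifferentiableAt ℂ (fun w : ℂ => Ring.inverse (1 - w • a)) z :=
  (differentiableAt_inverse (𝕜 := ℂ) hz).comp z (f := fun w : ℂ => 1 - w • a) (by fun_prop)

theorem choose_smul_pow_eq_circleIntegral {A : Type*} [NormedRing A] [NormedAlgebra ℂ A]
    [CompleteSpace A] (a : A) (hu : ∀ z : ℂ, ‖z‖ < 1 → IsUnit (1 - z • a)) (n k : ℕ) {ρ : ℝ}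
    (h0 : 0 < ρ) (h1 : ρ < 1) :
    ((n + k).choose k : ℂ) • a ^ n = (2 * Real.pi * Complex.I : ℂ)⁻¹ •
      ∮ z in C(0, ρ), (1 / z) ^ n • z⁻¹ • Ring.inverse (1 - z • a) ^ (k + 1) := by
  lift ρ to NNReal using h0.le
  set G : ℂ → A := fun z => Ring.inverse (1 - z • a) ^ (k + 1) with hG
  have hd : DifferentiableOn ℂ G (Metric.closedBall 0 ρ) := by
    intro z hz
    have hz' : ‖z‖ < 1 := lt_of_le_of_lt (by simpa using hz) h1
    exact ((differentiableAt_inverse_one_sub_smul a (hu z hz')).pow (k + 1)).differentiableWithinAt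
  have hC := (hd.hasFPowerSeriesOnBall (by exact_mod_cast h0)).hasFPowerSeriesAt
  let p : FormalMultilinearSeries ℂ ℂ A := fun m =>
    ContinuousMultilinearMap.mkPiRing ℂ (Fin m) (((m + k).choose k : ℂ) • a ^ m)
  have hS : HasFPowerSeriesAt G p 0 := by
    refine hasFPowerSeriesAt_iff.mpr ?_
    have hlim : Filter.Tendsto (fun z : ℂ => ‖z • a‖) (nhds 0) (nhds 0) := by
      have : Continuous (fun z : ℂ => ‖z • a‖) := by fun_prop
      simpa using this.tendsto 0
    filter_upwards [hlim.eventually_lt_const one_pos] with z hz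
    have e : (fun m => z ^ m • p.coeff m) = fun m => ((m + k).choose k : A) * (z • a) ^ m := by
      ext m
      simp only [p, FormalMultilinearSeries.coeff, ContinuousMultilinearMap.mkPiRing_apply,
        smul_pow, Pi.one_apply, Finset.prod_const_one, one_smul, Nat.cast_smul_eq_nsmul,
        nsmul_eq_mul, mul_smul_comm]
    rw [e, zero_add]
    exact hasSum_choose_mul_geometric_of_norm_lt_one' k hz
  have h : p n (fun _ => 1) = cauchyPowerSeries G 0 ρ n (fun _ => 1) := by
    rw [hS.eq_formalMultilinearSeries hC]
  rw [cauchyPowerSeries_apply] at h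
  simpa only [p, ContinuousMultilinearMap.mkPiRing_apply, Finset.prod_const_one, one_smul,
    sub_zero] using h

theorem choose_mul_norm_pow_succ_sub_pow_le {A : Type*} [NormedRing A] [NormedAlgebra ℂ A]
    [CompleteSpace A] (a : A) (hu : ∀ z : ℂ, ‖z‖ < 1 → IsUnit (1 - z • a)) (n k : ℕ) {ρ : ℝ}
    (h0 : 0 < ρ) (h1 : ρ < 1) :
    ((n + k).choose k : ℝ) * ‖a ^ (n + 1) - a ^ n‖ ≤ (2 * Real.pi)⁻¹ *
      ∫ θ in (0 : ℝ)..2 * Real.pi, (1 / ρ) ^ n *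
        ‖((n + 1) / (n + 1 + k) : ℂ) * (circleMap 0 ρ θ)⁻¹ - 1‖ *
          ‖Ring.inverse (1 - circleMap 0 ρ θ • a) ^ (k + 1)‖ := by
  have key : ((n + k).choose k : ℂ) • (a ^ (n + 1) - a ^ n) =
      (2 * Real.pi * Complex.I : ℂ)⁻¹ • ∮ z in C(0, ρ),
        (((n + 1) / (n + 1 + k) : ℂ) * z⁻¹ - 1) • (1 / z) ^ n • z⁻¹ •
          Ring.inverse (1 - z • a) ^ (k + 1) := by
    have hc : ((n + k).choose k : ℂ) =
        ((n + 1) / (n + 1 + k) : ℂ) * ((n + 1 + k).choose k : ℂ) := by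
      have h := Nat.choose_mul_succ_eq (n + k) k
      have h' : n + k + 1 - k = n + 1 := by omega
      rw [h'] at h
      have hne : (n + 1 + k : ℂ) ≠ 0 := by
        have : ((n + 1 + k : ℕ) : ℂ) ≠ 0 := Nat.cast_ne_zero.mpr (by omega)
        simpa using this
      have h2 : ((n + k).choose k : ℂ) * (n + k + 1) = ((n + 1 + k).choose k : ℂ) * (n + 1) := by
        rw [show n + 1 + k = n + k + 1 by omega]
        exact_mod_cast h
      field_simp
      linear_combination h2
    have hcont : ∀ m : ℕ, ContinuousOn
        (fun z : ℂ => (1 / z) ^ m • z⁻¹ • Ring.inverse (1 - z • a) ^ (k + 1))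
        (Metric.sphere 0 ρ) := by
      intro m z hz
      have hz' : ‖z‖ = ρ := by simpa using hz
      have hz0 : z ≠ 0 := norm_ne_zero_iff.mp (by linarith)
      have := ((differentiableAt_inverse_one_sub_smul a (hu z (by linarith))).pow
        (k + 1)).continuousAt
      refine ContinuousAt.continuousWithinAt ?_
      have h3 : ContinuousAt (fun z : ℂ => z⁻¹) z := continuousAt_inv₀ hz0
      simp only [one_div]
      exact (h3.pow m).smul (h3.smul this)
    rw [smul_sub, choose_smul_pow_eq_circleIntegral a hu n k h0 h1, hc, mul_smul,
      choose_smul_pow_eq_circleIntegral a hu (n + 1) k h0 h1, smul_comm, ← smul_sub,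
      ← circleIntegral.integral_smul, ← circleIntegral.integral_sub _ ((hcont n).circleIntegrable h0.le)]
    · congr 2
      ext z
      rw [sub_smul, one_smul, mul_smul]
      congr 2
      rw [smul_smul z⁻¹, pow_succ', one_div]
    · exact ((hcont (n + 1)).const_smul _).circleIntegrable h0.le
  have hn := congrArg norm key
  rw [norm_smul, norm_smul] at hn
  have hpi := Real.pi_pos
  have e1 : ‖((n + k).choose k : ℂ)‖ = ((n + k).choose k : ℝ) := by simp
  have e2 : ‖(2 * Real.pi * Complex.I : ℂ)⁻¹‖ = (2 * Real.pi)⁻¹ := by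
    simp [abs_of_pos hpi]
  rw [e1, e2] at hn
  rw [hn]
  refine mul_le_mul_of_nonneg_left ?_ (by positivity)
  refine (intervalIntegral.norm_integral_le_integral_norm (by positivity)).trans (le_of_eq ?_)
  refine intervalIntegral.integral_congr fun θ _ => ?_
  simp only [norm_smul, deriv_circleMap, norm_mul, norm_circleMap_zero, Complex.norm_I, norm_pow,
    norm_div, norm_inv, abs_of_pos h0, norm_one]
  field_simp

theorem le_norm_one_sub_circleMap {ρ θ : ℝ} (h0 : 1 / 2 ≤ ρ) (h1 : ρ ≤ 1) (hθ : 0 ≤ θ)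
    (hθ' : θ ≤ Real.pi) : (1 / 4) * (1 - ρ + θ) ≤ ‖1 - circleMap 0 ρ θ‖ := by
  have hpi := Real.pi_pos
  have hpi4 := Real.pi_le_four
  have hs : θ / 4 ≤ Real.sin (θ / 2) := by
    have h := Real.mul_le_sin (x := θ / 2) (by linarith) (by linarith)
    refine le_trans ?_ h
    have : 2 / Real.pi * (θ / 2) = θ / Real.pi := by field_simp
    rw [this]
    exact div_le_div_of_nonneg_left hθ hpi hpi4
  have hsq : ‖1 - circleMap 0 ρ θ‖ ^ 2 = (1 - ρ) ^ 2 + 4 * ρ * Real.sin (θ / 2) ^ 2 := by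
    have hc : Real.cos θ = 1 - 2 * Real.sin (θ / 2) ^ 2 := by
      have := Real.cos_sq_add_sin_sq (θ / 2)
      rw [show θ = 2 * (θ / 2) by ring, Real.cos_two_mul]
      rw [show 2 * (θ / 2) / 2 = θ / 2 by ring]
      linarith
    rw [← Complex.normSq_eq_norm_sq, Complex.normSq_apply, circleMap]
    simp only [zero_add, Complex.sub_re, Complex.sub_im, Complex.one_re, Complex.one_im,
      Complex.re_ofReal_mul, Complex.im_ofReal_mul, Complex.exp_ofReal_mul_I_re,
      Complex.exp_ofReal_mul_I_im]
    have h2 := Real.cos_sq_add_sin_sq θ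
    linear_combination ρ ^ 2 * h2 - 2 * ρ * hc
  refine (pow_le_pow_iff_left₀ (by linarith) (norm_nonneg _) two_ne_zero).mp ?_
  rw [hsq]
  have h3 : (θ / 4) ^ 2 ≤ Real.sin (θ / 2) ^ 2 := by
    apply pow_le_pow_left₀ (by linarith) hs
  nlinarith [sq_nonneg (1 - ρ - θ), sq_nonneg (Real.sin (θ / 2)), sq_nonneg (1 - ρ)]

theorem integral_norm_one_sub_circleMap_rpow_le {γ ρ : ℝ} (hγ : 1 ≤ γ) (h0 : 1 / 2 ≤ ρ)
    (h1 : ρ < 1) :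
    ∫ θ in (0 : ℝ)..2 * Real.pi, ‖1 - circleMap 0 ρ θ‖ ^ (1 - γ) ≤
      2 * (1 / 4) ^ (1 - γ) * ∫ θ in (0 : ℝ)..Real.pi, (1 - ρ + θ) ^ (1 - γ) := by
  have hpi := Real.pi_pos
  set f : ℝ → ℝ := fun θ => ‖1 - circleMap 0 ρ θ‖ ^ (1 - γ) with hf
  have hpos : ∀ θ, 0 < ‖1 - circleMap 0 ρ θ‖ := by
    intro θ
    have := norm_sub_norm_le (1 : ℂ) (circleMap 0 ρ θ)
    rw [norm_one, norm_circleMap_zero, abs_of_pos (by linarith)] at this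
    linarith
  have hfc : Continuous f := by
    refine Continuous.rpow_const (by fun_prop) fun θ => Or.inl (hpos θ).ne'
  have hsymm : ∀ θ, f (2 * Real.pi - θ) = f θ := by
    intro θ
    simp only [hf]
    congr 1
    rw [← Complex.norm_conj (1 - circleMap 0 ρ θ)]
    congr 1
    simp only [circleMap, zero_add, map_sub, map_one, map_mul, Complex.conj_ofReal,
      ← Complex.exp_conj, Complex.conj_I]
    rw [show ((2 * Real.pi - θ : ℝ) : ℂ) * Complex.I = 2 * Real.pi * Complex.I + θ * -Complex.I by
      push_cast; ring, Complex.exp_add, Complex.exp_two_pi_mul_I, one_mul]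
  have hhalf : ∫ θ in Real.pi..2 * Real.pi, f θ = ∫ θ in (0 : ℝ)..Real.pi, f θ := by
    have h := intervalIntegral.integral_comp_sub_left (a := 0) (b := Real.pi) f (2 * Real.pi)
    rw [show 2 * Real.pi - Real.pi = Real.pi by ring, sub_zero] at h
    rw [← h]
    simp only [hsymm]
  have hle : ∫ θ in (0 : ℝ)..Real.pi, f θ ≤
      ∫ θ in (0 : ℝ)..Real.pi, (1 / 4) ^ (1 - γ) * (1 - ρ + θ) ^ (1 - γ) := by
    refine intervalIntegral.integral_mono_on hpi.le (hfc.intervalIntegrable _ _) ?_ ?_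
    · refine ContinuousOn.intervalIntegrable ?_
      rw [Set.uIcc_of_le hpi.le]
      refine continuousOn_const.mul (ContinuousOn.rpow_const (by fun_prop) fun θ hθ => Or.inl ?_)
      have := hθ.1
      linarith
    · intro θ hθ
      have hp : 0 < 1 - ρ + θ := by linarith [hθ.1]
      rw [← Real.mul_rpow (by norm_num) hp.le]
      exact Real.rpow_le_rpow_of_nonpos (by positivity)
        (le_norm_one_sub_circleMap h0 h1.le hθ.1 hθ.2) (by linarith)
  rw [intervalIntegral.integral_const_mul] at hle
  rw [← intervalIntegral.integral_add_adjacent_intervals (hfc.intervalIntegrable 0 Real.pi)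
    (hfc.intervalIntegrable Real.pi (2 * Real.pi)), hhalf]
  linarith

theorem integral_norm_one_sub_circleMap_rpow_le_of_le_one {γ ρ : ℝ} (hγ : γ ≤ 1) (h0 : 0 ≤ ρ)
    (h1 : ρ ≤ 1) :
    ∫ θ in (0 : ℝ)..2 * Real.pi, ‖1 - circleMap 0 ρ θ‖ ^ (1 - γ) ≤
      2 * Real.pi * 2 ^ (1 - γ) := by
  have hpi := Real.pi_pos
  have h : ∫ θ in (0 : ℝ)..2 * Real.pi, ‖1 - circleMap 0 ρ θ‖ ^ (1 - γ) ≤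
      ∫ _ in (0 : ℝ)..2 * Real.pi, (2 : ℝ) ^ (1 - γ) := by
    refine intervalIntegral.integral_mono_on (by positivity) ?_ (by simp) fun θ _ => ?_
    · refine Continuous.intervalIntegrable ?_ _ _
      exact Continuous.rpow_const (by fun_prop) fun θ => Or.inr (by linarith)
    · refine Real.rpow_le_rpow (norm_nonneg _) ?_ (by linarith)
      refine (norm_sub_le _ _).trans ?_
      rw [norm_one, norm_circleMap_zero, abs_of_nonneg h0]
      linarith
  simpa using h

theorem integral_add_rpow {s d : ℝ} (hd : 0 < d) (hs : s ≠ 2) :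
    ∫ θ in (0 : ℝ)..Real.pi, (d + θ) ^ (1 - s) =
      ((d + Real.pi) ^ (2 - s) - d ^ (2 - s)) / (2 - s) := by
  have hpi := Real.pi_pos
  rw [intervalIntegral.integral_comp_add_left (fun x => x ^ (1 - s)) d, add_zero,
    integral_rpow (Or.inr ⟨fun h => hs (by linarith), ?_⟩), show 1 - s + 1 = 2 - s by ring]
  rw [Set.uIcc_of_le (by linarith)]
  exact fun h => absurd h.1 (by linarith)

theorem integral_add_rpow_two {d : ℝ} (hd : 0 < d) :
    ∫ θ in (0 : ℝ)..Real.pi, (d + θ) ^ (1 - 2 : ℝ) = Real.log ((d + Real.pi) / d) := by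
  have hpi := Real.pi_pos
  rw [intervalIntegral.integral_comp_add_left (fun x => x ^ (1 - 2 : ℝ)) d, add_zero]
  rw [← integral_inv_of_pos hd (by linarith)]
  refine intervalIntegral.integral_congr fun x _ => ?_
  rw [show (1 - 2 : ℝ) = -1 by norm_num]
  exact Real.rpow_neg_one x

theorem exists_integral_le_of_lt_two {γ : ℝ} (hγ : γ < 2) : ∃ K > (0 : ℝ), ∀ ρ : ℝ, 1 / 2 ≤ ρ →
    ρ < 1 → ∫ θ in (0 : ℝ)..2 * Real.pi, ‖1 - circleMap 0 ρ θ‖ ^ (1 - γ) ≤ K := by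
  have hpi := Real.pi_pos
  rcases le_total γ 1 with h | h
  · exact ⟨2 * Real.pi * 2 ^ (1 - γ), by positivity, fun ρ h0 h1 =>
      integral_norm_one_sub_circleMap_rpow_le_of_le_one h (by linarith) h1.le⟩
  · have hg : 0 < 2 - γ := by linarith
    refine ⟨2 * (1 / 4) ^ (1 - γ) * ((1 + Real.pi) ^ (2 - γ) / (2 - γ)), by positivity,
      fun ρ h0 h1 => (integral_norm_one_sub_circleMap_rpow_le h h0 h1).trans ?_⟩
    rw [integral_add_rpow (by linarith) hγ.ne]
    gcongr
    have e1 : (1 - ρ + Real.pi) ^ (2 - γ) ≤ (1 + Real.pi) ^ (2 - γ) :=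
      Real.rpow_le_rpow (by linarith) (by linarith) hg.le
    have e2 : 0 ≤ (1 - ρ) ^ (2 - γ) := Real.rpow_nonneg (by linarith) _
    linarith

theorem exists_integral_le_of_eq_two : ∃ K > (0 : ℝ), ∀ ρ : ℝ, 1 / 2 ≤ ρ →
    ρ < 1 → ∫ θ in (0 : ℝ)..2 * Real.pi, ‖1 - circleMap 0 ρ θ‖ ^ (1 - 2 : ℝ) ≤
      K * (1 + Real.log (1 / (1 - ρ))) := by
  have hpi := Real.pi_pos
  refine ⟨2 * (1 / 4) ^ (1 - 2 : ℝ) * 5, by positivity,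
      fun ρ h0 h1 => (integral_norm_one_sub_circleMap_rpow_le (by norm_num) h0 h1).trans ?_⟩
  have hd : 0 < 1 - ρ := by linarith
  rw [integral_add_rpow_two hd, mul_assoc _ (5 : ℝ)]
  have e : Real.log ((1 - ρ + Real.pi) / (1 - ρ)) ≤ 5 * (1 + Real.log (1 / (1 - ρ))) := by
    rw [div_eq_mul_one_div, Real.log_mul (by linarith) (by positivity)]
    have h2 : Real.log (1 - ρ + Real.pi) ≤ 5 :=
      (Real.log_le_self (by linarith)).trans (by linarith [Real.pi_le_four])
    have h3 : 0 ≤ Real.log (1 / (1 - ρ)) :=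
      Real.log_nonneg (by rw [le_div_iff₀ hd]; linarith)
    linarith
  gcongr

theorem exists_integral_le_of_two_lt {γ : ℝ} (hγ : 2 < γ) : ∃ K > (0 : ℝ), ∀ ρ : ℝ, 1 / 2 ≤ ρ →
    ρ < 1 → ∫ θ in (0 : ℝ)..2 * Real.pi, ‖1 - circleMap 0 ρ θ‖ ^ (1 - γ) ≤
      K * (1 / (1 - ρ)) ^ (γ - 2) := by
  have hpi := Real.pi_pos
  have hg : 0 < γ - 2 := by linarith
  refine ⟨2 * (1 / 4) ^ (1 - γ) * (1 / (γ - 2)), by positivity,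
      fun ρ h0 h1 => (integral_norm_one_sub_circleMap_rpow_le (by linarith) h0 h1).trans ?_⟩
  have hd : 0 < 1 - ρ := by linarith
  rw [integral_add_rpow hd hγ.ne', mul_assoc _ (1 / (γ - 2))]
  gcongr
  rw [one_div (1 - ρ), Real.inv_rpow hd.le, ← Real.rpow_neg hd.le, neg_sub,
    ← neg_div_neg_eq, neg_sub, neg_sub, div_mul_eq_mul_div, one_mul]
  gcongr
  linarith [Real.rpow_nonneg (show 0 ≤ 1 - ρ + Real.pi by linarith) (2 - γ)]

theorem IsRK.isUnit_one_sub_smul {X : Type*} [NormedAddCommGroup X] [NormedSpace ℂ X]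
    {T : X →L[ℂ] X} {α β C : ℝ} (hT : IsRK T α β C) {z : ℂ} (hz : ‖z‖ < 1) :
    IsUnit (1 - z • T) := by
  rcases eq_or_ne z 0 with rfl | hz0
  · simp
  · have h1 : 1 < ‖z⁻¹‖ := by
      rw [norm_inv]
      exact (one_lt_inv₀ (norm_pos_iff.mpr hz0)).mpr hz
    have hu := ((Units.mk0 z hz0).isUnit.map (algebraMap ℂ (X →L[ℂ] X))).mul (hT.2 z⁻¹ h1).1
    convert hu using 1
    rw [Units.val_mk0, mul_sub, ← map_mul, mul_inv_cancel₀ hz0, map_one, Algebra.smul_def]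

theorem IsRK.norm_inverse_one_sub_smul_le {X : Type*} [NormedAddCommGroup X] [NormedSpace ℂ X]
    {T : X →L[ℂ] X} {α β C : ℝ} (hT : IsRK T α β C) {z : ℂ} (hz0 : z ≠ 0) (hz : ‖z‖ < 1) :
    ‖Ring.inverse (1 - z • T)‖ ≤ C * (1 / (1 - ‖z‖)) ^ β * ‖1 - z‖ ^ (-α) := by
  have hr : 0 < ‖z‖ := norm_pos_iff.mpr hz0
  have h1 : 1 < ‖z⁻¹‖ := by
    rw [norm_inv]
    exact (one_lt_inv₀ hr).mpr hz
  obtain ⟨hu, hb⟩ := hT.2 z⁻¹ h1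
  have hinv : Ring.inverse (1 - z • T) =
      z⁻¹ • Ring.inverse (algebraMap ℂ (X →L[ℂ] X) z⁻¹ - T) := by
    have hfac : 1 - z • T = z • (algebraMap ℂ (X →L[ℂ] X) z⁻¹ - T) := by
      rw [smul_sub, Algebra.algebraMap_eq_smul_one, smul_smul, mul_inv_cancel₀ hz0, one_smul]
    have hm : (1 - z • T) * (z⁻¹ • Ring.inverse (algebraMap ℂ (X →L[ℂ] X) z⁻¹ - T)) = 1 := by
      rw [hfac, smul_mul_smul_comm, mul_inv_cancel₀ hz0, one_smul, Ring.mul_inverse_cancel _ hu]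
    calc Ring.inverse (1 - z • T)
        = Ring.inverse (1 - z • T) * ((1 - z • T) *
            (z⁻¹ • Ring.inverse (algebraMap ℂ (X →L[ℂ] X) z⁻¹ - T))) := by rw [hm, mul_one]
      _ = _ := by
        rw [← mul_assoc, Ring.inverse_mul_cancel _ (hT.isUnit_one_sub_smul hz), one_mul]
  have hd : 0 < 1 - ‖z‖ := by linarith
  have hs : 0 < ‖1 - z‖ := by
    have := norm_sub_norm_le (1 : ℂ) z
    rw [norm_one] at this
    linarith
  have e1 : ‖z⁻¹ - 1‖ = ‖1 - z‖ / ‖z‖ := by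
    rw [← norm_div]
    congr 1
    field_simp
  have e2 : ‖z⁻¹‖ - 1 = (1 - ‖z‖) / ‖z‖ := by
    rw [norm_inv]
    field_simp
  rw [e1, e2, norm_inv] at hb
  rw [hinv, norm_smul, norm_inv]
  refine (mul_le_mul_of_nonneg_left hb (by positivity)).trans (le_of_eq ?_)
  rw [Real.div_rpow hs.le hr.le, Real.div_rpow hd.le hr.le, Real.inv_rpow hr.le,
    Real.rpow_sub_one hr.ne', Real.rpow_add hr, one_div, Real.inv_rpow hd.le, Real.rpow_neg hs.le]
  have p1 := Real.rpow_pos_of_pos hr α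
  have p2 := Real.rpow_pos_of_pos hr β
  have p3 := Real.rpow_pos_of_pos hd β
  have p4 := Real.rpow_pos_of_pos hs α
  field_simp

theorem IsRK.exists_norm_pow_succ_sub_pow_le {X : Type*} [NormedAddCommGroup X]
    [NormedSpace ℂ X] [CompleteSpace X] {T : X →L[ℂ] X} {α β C : ℝ} (hβ : 0 ≤ β)
    (hT : IsRK T α β C) (k : ℕ) :
    ∃ K > (0 : ℝ), ∀ n : ℕ, 1 ≤ n → ‖T ^ (n + 1) - T ^ n‖ ≤
      K * (n : ℝ) ^ ((k : ℝ) * (β - 1) + β) *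
        ∫ θ in (0 : ℝ)..2 * Real.pi,
          ‖1 - circleMap 0 ((n : ℝ) / (n + 1)) θ‖ ^ (1 - α * (k + 1)) := by
  have hC : 0 < C := lt_of_lt_of_le one_pos hT.1
  have hpi := Real.pi_pos
  refine ⟨k.factorial * ((2 * Real.pi)⁻¹ *
    (3 * (2 * (1 + k)) * (C ^ (k + 1) * 2 ^ (β * (k + 1))))), by positivity, fun n hn => ?_⟩
  have hn1 : (1 : ℝ) ≤ n := by exact_mod_cast hn
  have hn0 : (0 : ℝ) < n := by linarith
  set ρ : ℝ := (n : ℝ) / (n + 1) with hρ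
  have h0 : 0 < ρ := by positivity
  have h1 : ρ < 1 := by rw [hρ, div_lt_one (by positivity)]; linarith
  have hhalf : 1 / 2 ≤ ρ := by rw [hρ, div_le_div_iff₀ (by norm_num) (by positivity)]; linarith
  have hd : 1 - ρ = 1 / (n + 1) := by rw [hρ]; field_simp; ring
  have hdist : ∀ θ, 1 - ρ ≤ ‖1 - circleMap 0 ρ θ‖ := by
    intro θ
    have := norm_sub_norm_le (1 : ℂ) (circleMap 0 ρ θ)
    rwa [norm_one, norm_circleMap_zero, abs_of_pos h0] at this
  have hpos : ∀ θ, 0 < ‖1 - circleMap 0 ρ θ‖ := fun θ => by linarith [hdist θ]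
  have hcirc : ∀ θ, ‖circleMap 0 ρ θ‖ = ρ := fun θ => by
    rw [norm_circleMap_zero, abs_of_pos h0]
  have hne : ∀ θ, circleMap 0 ρ θ ≠ 0 := fun θ => norm_ne_zero_iff.mp (by rw [hcirc]; exact h0.ne')
  have hexp : (1 / ρ) ^ n ≤ 3 := by
    have e : 1 / ρ = 1 / (n : ℝ) + 1 := by rw [hρ]; field_simp; ring
    have h := Real.add_one_le_exp (1 / (n : ℝ))
    rw [e]
    calc (1 / (n : ℝ) + 1) ^ n ≤ Real.exp (1 / n) ^ n := by gcongr
      _ = Real.exp 1 := by rw [← Real.exp_nat_mul]; congr 1; field_simp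
      _ ≤ 3 := by linarith [Real.exp_one_lt_d9]
  have hweight : ∀ θ, ‖((n + 1) / (n + 1 + k) : ℂ) * (circleMap 0 ρ θ)⁻¹ - 1‖ ≤
      2 * (1 + k) * ‖1 - circleMap 0 ρ θ‖ := by
    intro θ
    set z := circleMap 0 ρ θ with hz
    have hz0 : z ≠ 0 := hne θ
    have hnk : (n + 1 + k : ℂ) ≠ 0 := by
      have : ((n + 1 + k : ℕ) : ℂ) ≠ 0 := Nat.cast_ne_zero.mpr (by omega)
      simpa using this
    have e : ((n + 1) / (n + 1 + k) : ℂ) * z⁻¹ - 1 =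
        z⁻¹ * ((1 - z) - ((k / (n + 1 + k) : ℝ) : ℂ)) := by
      push_cast
      field_simp
      ring
    have hzi : ‖z⁻¹‖ ≤ 2 := by
      rw [norm_inv, hcirc]
      exact inv_le_of_inv_le₀ (by norm_num) (by linarith)
    have hk : (k / (n + 1 + k) : ℝ) ≤ k * ‖1 - z‖ := by
      refine le_trans ?_ (mul_le_mul_of_nonneg_left (hdist θ) (Nat.cast_nonneg k))
      rw [hd, mul_one_div]
      refine div_le_div_of_nonneg_left (by positivity) (by positivity) ?_
      linarith [Nat.cast_nonneg (α := ℝ) k]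
    have hs : ‖(1 - z) - ((k / (n + 1 + k) : ℝ) : ℂ)‖ ≤ (1 + k) * ‖1 - z‖ := by
      refine (norm_sub_le _ _).trans ?_
      rw [Complex.norm_real, Real.norm_of_nonneg (by positivity)]
      linarith
    rw [e, norm_mul, mul_assoc]
    exact mul_le_mul hzi hs (norm_nonneg _) (by norm_num)
  have hres : ∀ θ, ‖Ring.inverse (1 - circleMap 0 ρ θ • T) ^ (k + 1)‖ ≤
      C ^ (k + 1) * 2 ^ (β * (k + 1)) * (n : ℝ) ^ (β * (k + 1)) *
        ‖1 - circleMap 0 ρ θ‖ ^ (-(α * (k + 1))) := by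
    intro θ
    have h := hT.norm_inverse_one_sub_smul_le (hne θ) (by rw [hcirc]; exact h1)
    rw [hcirc, hd, one_div_one_div] at h
    refine (norm_pow_le' _ k.succ_pos).trans ((pow_le_pow_left₀ (norm_nonneg _) h _).trans ?_)
    have e : ∀ x y : ℝ, 0 ≤ x → (x ^ y) ^ (k + 1) = x ^ (y * (k + 1)) := by
      intro x y hx
      rw [← Real.rpow_mul_natCast hx]
      push_cast
      rfl
    rw [Nat.succ_eq_add_one, mul_pow, mul_pow, e _ _ (by positivity), e _ _ (norm_nonneg _),
      neg_mul, mul_assoc (C ^ (k + 1)) (2 ^ _), ← Real.mul_rpow (by norm_num) hn0.le]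
    gcongr
    linarith
  have hchoose : (n : ℝ) ^ k / k.factorial ≤ (n + k).choose k := by
    refine le_trans ?_ (Nat.pow_le_choose (α := ℝ) k (n + k))
    rw [show n + k + 1 - k = n + 1 by omega]
    gcongr
    linarith
  have hmain := choose_mul_norm_pow_succ_sub_pow_le T
    (fun z hz => hT.isUnit_one_sub_smul hz) n k h0 h1
  have hcontz : Continuous fun θ => (circleMap 0 ρ θ)⁻¹ :=
    (continuous_circleMap 0 ρ).inv₀ hne
  have hcontF : Continuous fun θ => Ring.inverse (1 - circleMap 0 ρ θ • T) :=
    continuous_iff_continuousAt.mpr fun θ =>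
      (differentiableAt_inverse_one_sub_smul T (hT.isUnit_one_sub_smul
        (by rw [hcirc]; exact h1))).continuousAt.comp
          (f := circleMap 0 ρ) (continuous_circleMap 0 ρ).continuousAt
  have hcontI : Continuous fun θ => ‖1 - circleMap 0 ρ θ‖ ^ (1 - α * (k + 1)) :=
    Continuous.rpow_const (by fun_prop) fun θ => Or.inl (hpos θ).ne'
  have hint : ∫ θ in (0 : ℝ)..2 * Real.pi, (1 / ρ) ^ n *
        ‖((n + 1) / (n + 1 + k) : ℂ) * (circleMap 0 ρ θ)⁻¹ - 1‖ *
          ‖Ring.inverse (1 - circleMap 0 ρ θ • T) ^ (k + 1)‖ ≤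
      ∫ θ in (0 : ℝ)..2 * Real.pi, 3 * (2 * (1 + k)) * (C ^ (k + 1) * 2 ^ (β * (k + 1))) *
        (n : ℝ) ^ (β * (k + 1)) * ‖1 - circleMap 0 ρ θ‖ ^ (1 - α * (k + 1)) := by
    refine intervalIntegral.integral_mono_on (by positivity)
      (Continuous.intervalIntegrable (by fun_prop) _ _)
      (Continuous.intervalIntegrable (by fun_prop) _ _) fun θ _ => ?_
    refine (mul_le_mul (mul_le_mul hexp (hweight θ) (norm_nonneg _) (by norm_num)) (hres θ)
      (norm_nonneg _) (by positivity)).trans (le_of_eq ?_)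
    rw [sub_eq_add_neg (1 : ℝ) (α * (k + 1)), Real.rpow_add (hpos θ), Real.rpow_one]
    ring
  rw [intervalIntegral.integral_const_mul] at hint
  have hfin : (n : ℝ) ^ k / k.factorial * ‖T ^ (n + 1) - T ^ n‖ ≤ _ :=
    (mul_le_mul_of_nonneg_right hchoose (norm_nonneg _)).trans
      (hmain.trans (mul_le_mul_of_nonneg_left hint (by positivity)))
  have hpow : (n : ℝ) ^ ((k : ℝ) * (β - 1) + β) = (n : ℝ) ^ (β * (k + 1)) / (n : ℝ) ^ k := by
    rw [← Real.rpow_natCast, ← Real.rpow_sub hn0]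
    congr 1
    ring
  have hfac : (0 : ℝ) < k.factorial := by positivity
  rw [div_mul_eq_mul_div, div_le_iff₀ hfac, ← le_div_iff₀' (by positivity)] at hfin
  refine hfin.trans (le_of_eq ?_)
  rw [hpow]
  ring

/-- Power difference estimates for an `(α,β)`-RK operator, according to the size of `α(k+1)`
relative to `2`. -/
theorem power_difference_bounds
    {X : Type*} [NormedAddCommGroup X] [NormedSpace ℂ X] [CompleteSpace X]
    (T : X →L[ℂ] X) (α β C : ℝ) (hα : 0 ≤ α) (hβ : 0 ≤ β) (hT : IsRK T α β C)
    (k : ℕ) :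
    ∃ M > (0 : ℝ), ∃ N : ℕ, ∀ n : ℕ, N ≤ n →
      (α * (k + 1) < 2 →
        ‖T ^ (n + 1) - T ^ n‖ ≤ M * (n : ℝ) ^ ((k : ℝ) * (β - 1) + β)) ∧
      (α * (k + 1) = 2 →
        ‖T ^ (n + 1) - T ^ n‖ ≤ M * (n : ℝ) ^ ((k : ℝ) * (β - 1) + β) * Real.log n) ∧
      (2 < α * (k + 1) →
        ‖T ^ (n + 1) - T ^ n‖ ≤ M * (n : ℝ) ^ ((α + β - 1) * (k + 1) - 1)) := by
  obtain ⟨K, hK, hb⟩ := hT.exists_norm_pow_succ_sub_pow_le hβ k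
  have hρ : ∀ n : ℕ, 2 ≤ n → 1 / 2 ≤ (n : ℝ) / (n + 1) ∧ (n : ℝ) / (n + 1) < 1 ∧
      1 / (1 - (n : ℝ) / (n + 1)) = n + 1 := by
    intro n hn
    have hn1 : (2 : ℝ) ≤ n := by exact_mod_cast hn
    refine ⟨?_, ?_, ?_⟩
    · rw [div_le_div_iff₀ (by norm_num) (by positivity)]
      linarith
    · rw [div_lt_one (by positivity)]
      linarith
    · rw [show 1 - (n : ℝ) / (n + 1) = 1 / (n + 1) by field_simp; ring, one_div_one_div]
  rcases lt_trichotomy (α * (k + 1)) 2 with h | h | h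
  · obtain ⟨L, hL, hI⟩ := exists_integral_le_of_lt_two h
    refine ⟨K * L, by positivity, 2, fun n hn => ⟨fun _ => ?_, fun h' => absurd h' h.ne,
      fun h' => absurd h' h.not_gt⟩⟩
    refine (hb n (by omega)).trans ?_
    rw [mul_right_comm K L]
    exact mul_le_mul_of_nonneg_left (hI _ (hρ n hn).1 (hρ n hn).2.1) (by positivity)
  · obtain ⟨L, hL, hI⟩ := exists_integral_le_of_eq_two
    refine ⟨K * (L * 4), by positivity, 2, fun n hn => ⟨fun h' => absurd h h'.ne, fun _ => ?_,
      fun h' => absurd h h'.ne'⟩⟩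
    obtain ⟨h1, h2, h3⟩ := hρ n hn
    have hn1 : (2 : ℝ) ≤ n := by exact_mod_cast hn
    refine (hb n (by omega)).trans ?_
    rw [mul_right_comm K (L * 4), mul_assoc (K * (n : ℝ) ^ ((k : ℝ) * (β - 1) + β))]
    refine mul_le_mul_of_nonneg_left ?_ (by positivity)
    rw [h]
    refine (hI _ h1 h2).trans ?_
    rw [h3, mul_assoc]
    refine mul_le_mul_of_nonneg_left ?_ hL.le
    have e1 : Real.log (n + 1) ≤ 2 * Real.log n := by
      rw [← Real.log_rpow (show (0 : ℝ) < n by linarith)]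
      refine Real.log_le_log (by positivity) ?_
      rw [Real.rpow_two]
      nlinarith
    have e2 : Real.log 2 ≤ Real.log n := Real.log_le_log (by norm_num) hn1
    linarith [Real.log_two_gt_d9]
  · obtain ⟨L, hL, hI⟩ := exists_integral_le_of_two_lt h
    refine ⟨K * (L * 2 ^ (α * (k + 1) - 2)), by positivity, 2, fun n hn =>
      ⟨fun h' => absurd h' h.not_gt, fun h' => absurd h' h.ne', fun _ => ?_⟩⟩
    obtain ⟨h1, h2, h3⟩ := hρ n hn
    have hn1 : (2 : ℝ) ≤ n := by exact_mod_cast hn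
    refine (hb n (by omega)).trans ?_
    rw [show (α + β - 1) * ((k : ℝ) + 1) - 1 = (k * (β - 1) + β) + (α * (k + 1) - 2) by ring,
      Real.rpow_add (by positivity) _ (α * (k + 1) - 2), show ∀ a b c : ℝ, K * (L * a) * (b * c) =
        K * b * (L * (a * c)) by intros; ring, ← Real.mul_rpow (by norm_num) (by positivity)]
    refine mul_le_mul_of_nonneg_left ?_ (by positivity)
    refine (hI _ h1 h2).trans ?_
    rw [h3]
    refine mul_le_mul_of_nonneg_left ?_ hL.le
    exact Real.rpow_le_rpow (by positivity) (by linarith) (by linarith)
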